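/- If G is a finite connected simple Class 0 graph on n vertices with diameter at least 3, then the number of edges of G satisfies e(G) ≥ (5/3)n − 11/3. -/

import Mathlib

/-- A single pebbling move on a graph `G`: remove two pebbles from a vertex `u`
(which must carry at least two pebbles) and add one pebble on a neighbor `v` of `u`. -/
def PebblingMove {V : Type*} (G : SimpleGraph V) (p q : V → ℕ) : Prop :=
  ∃ u v : V, G.Adj u v ∧ 2 ≤ p u ∧ q u = p u - 2 ∧ q v = p v + 1 ∧
    ∀ x : V, x ≠ u → x ≠ v → q x = p x

/-- A configuration `p` is solvable for the root `r` if some sequence of pebbling moves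
starting from `p` produces a configuration with at least one pebble on `r`. -/
def PebblingSolvable {V : Type*} (G : SimpleGraph V) (r : V) (p : V → ℕ) : Prop :=
  ∃ q : V → ℕ, Relation.ReflTransGen (PebblingMove G) p q ∧ 1 ≤ q r

/-- The rooted pebbling number `π(G, r)`: the least `k` such that every configuration
of size `k` is solvable for the root `r`. -/
noncomputable def rootedPebblingNumber {V : Type*} [Fintype V] (G : SimpleGraph V) (r : V) : ℕ :=
  sInf {k : ℕ | ∀ p : V → ℕ, (∑ v, p v) = k → PebblingSolvable G r p}

/-- The pebbling number `π(G)`: the least `k` such that for every root `r`, every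
configuration of size `k` is solvable for `r`. -/
noncomputable def pebblingNumber {V : Type*} [Fintype V] (G : SimpleGraph V) : ℕ :=
  sInf {k : ℕ | ∀ (r : V) (p : V → ℕ), (∑ v, p v) = k → PebblingSolvable G r p}

/-- A graph is Class 0 if its pebbling number equals its number of vertices. -/
def Class0 {V : Type*} [Fintype V] (G : SimpleGraph V) : Prop :=
  pebblingNumber G = Fintype.card V

section

variable {V : Type*} [Fintype V] [DecidableEq V] {G : SimpleGraph V}

/-- A weighted excess over the thresholds given by the indicator of `T` does not increase along
pebbling moves. -/
theorem PebblingMove.weight_le {w : V → ℕ} {T : Finset V}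
    (hw : ∀ u v, G.Adj u v → w v ≤ 2 * w u) (hT : ∀ u ∈ T, ∀ v, G.Adj u v → w v ≤ w u)
    {p q : V → ℕ} (h : PebblingMove G p q) :
    ∑ v, w v * (q v - if v ∈ T then 1 else 0) ≤ ∑ v, w v * (p v - if v ∈ T then 1 else 0) := by
  obtain ⟨u, v, huv, hu, hqu, hqv, hx⟩ := h
  have hv : v ∈ Finset.univ.erase u := by simp [huv.ne']
  have key (f : V → ℕ) : ∑ x, f x = f u + (f v + ∑ x ∈ (Finset.univ.erase u).erase v, f x) := by
    rw [Finset.add_sum_erase _ _ hv, Finset.add_sum_erase _ _ (Finset.mem_univ u)]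
  rw [key, key, ← add_assoc, ← add_assoc]
  refine Nat.add_le_add ?_ (Finset.sum_le_sum fun x hx' => ?_)
  · have h1 : w v * (q v - if v ∈ T then 1 else 0) ≤
        w v * (p v - if v ∈ T then 1 else 0) + w v := by
      rw [← Nat.mul_succ]
      exact Nat.mul_le_mul_left _ (by omega)
    have h2 : w u * (q u - if u ∈ T then 1 else 0) + w v ≤
        w u * (p u - if u ∈ T then 1 else 0) := by
      by_cases hm : u ∈ T
      · have := hT u hm v huv
        obtain ⟨k, hk⟩ : ∃ k, p u = k + 2 := ⟨p u - 2, by omega⟩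
        simp only [hm, if_true, hqu, hk]
        have : w u * (k + 2 - 2 - 1) ≤ w u * k := Nat.mul_le_mul_left _ (by omega)
        have h3 : k + 2 - 1 = k + 1 := by omega
        rw [h3, Nat.mul_succ]
        omega
      · have := hw u v huv
        obtain ⟨k, hk⟩ : ∃ k, p u = k + 2 := ⟨p u - 2, by omega⟩
        simp only [hm, if_false, hqu, hk, Nat.add_sub_cancel, Nat.sub_zero, Nat.mul_add]
        omega
    omega
  · simp only [Finset.mem_erase] at hx'
    rw [hx x hx'.2.1 hx'.1]

/-- If every configuration of size `|V|` is solvable, then the weight of a root is at most the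
number of vertices outside `T`. -/
theorem weight_le_card_of_solvable
    (hsol : ∀ (r : V) (p : V → ℕ), ∑ v, p v = Fintype.card V → PebblingSolvable G r p)
    {w : V → ℕ} {S : Finset V} {r u : V}
    (hw : ∀ u v, G.Adj u v → w v ≤ 2 * w u) (hT : ∀ u ∉ S, ∀ v, G.Adj u v → w v ≤ w u)
    (hr : r ∈ S) (hwu : w u = 1) : w r ≤ S.card := by
  by_contra! hlt
  obtain ⟨q, hq, hqr⟩ := hsol r
    (fun v => (if v ∈ Sᶜ then 1 else 0) + if v = u then S.card else 0) (by
      rw [Finset.sum_add_distrib, Finset.sum_ite_eq' Finset.univ u fun _ => S.card]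
      simp only [Finset.sum_boole, Finset.filter_mem_eq_inter, Finset.univ_inter,
        Finset.mem_univ, if_true, Nat.cast_id]
      exact Finset.card_compl_add_card S)
  have hmono : ∀ {p q : V → ℕ}, Relation.ReflTransGen (PebblingMove G) p q →
      ∑ v, w v * (q v - if v ∈ Sᶜ then 1 else 0) ≤
        ∑ v, w v * (p v - if v ∈ Sᶜ then 1 else 0) := by
    intro p q h
    induction h with
    | refl => exact le_rfl
    | tail _ hm ih =>
      exact (hm.weight_le hw fun u hu => hT u (Finset.mem_compl.1 hu)).trans ih
  have h1 := hmono hq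
  simp only [Nat.add_sub_cancel_left, mul_ite, mul_zero] at h1
  rw [Finset.sum_ite_eq' Finset.univ u fun v => w v * S.card] at h1
  have h2 := Finset.single_le_sum (f := fun v => w v * (q v - if v ∈ Sᶜ then 1 else 0))
    (fun _ _ => Nat.zero_le _) (Finset.mem_univ r)
  simp only [Finset.mem_compl, hr, not_true_eq_false, if_false, Nat.sub_zero] at h2
  have h3 := Nat.mul_le_mul_left (w r) hqr
  simp only [Finset.mem_univ, if_true, hwu, Finset.mem_compl] at h1
  omega

/-- A Class 0 graph has no cut vertex. -/
theorem no_cut_vertex_of_solvable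
    (hsol : ∀ (r : V) (p : V → ℕ), ∑ v, p v = Fintype.card V → PebblingSolvable G r p)
    {A : Finset V} {r c s : V} (hr : r ∈ A) (hs : s ∉ A) (hsc : s ≠ c)
    (hA : ∀ u ∈ A, ∀ v, G.Adj u v → v ∈ A ∨ v = c) : False := by
  have hA' : ∀ u v, G.Adj u v → v ∈ A → u ∈ A ∨ u = c := fun u v h hv => hA v hv u h.symm
  have := weight_le_card_of_solvable hsol (S := {r, c, s}) (r := r) (u := s)
    (w := fun v => if v ∈ A then 4 else if v = s then 1 else 2)
    (by
      intro u v huv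
      have := hA' u v huv
      by_cases hus : u = s
      · subst hus
        have : v ∉ A := fun hv => by tauto
        have : v ≠ u := huv.ne'
        simp [*]
      · split_ifs <;> omega)
    (by
      intro u hu v huv
      have := hA' u v huv
      simp only [Finset.mem_insert, Finset.mem_singleton, not_or] at hu
      have : v ∈ A → u ∈ A := fun hv => by tauto
      split_ifs <;> first | omega | tauto)
    (by simp) (by simp [hs])
  simp only [hr, if_true] at this
  have h3 := Finset.card_le_three (a := r) (b := c) (c := s)
  omega

/-- In a Class 0 graph, vertices at distance at least `3` have degree sum at least `6`. -/
theorem six_le_degree_add_degree [DecidableRel G.Adj]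
    (hsol : ∀ (r : V) (p : V → ℕ), ∑ v, p v = Fintype.card V → PebblingSolvable G r p)
    {r u : V} (hne : u ≠ r) (hadj : ¬ G.Adj r u) (hcom : ∀ t, G.Adj r t → ¬ G.Adj u t) :
    6 ≤ G.degree r + G.degree u := by
  have := weight_le_card_of_solvable hsol
    (S := insert r (G.neighborFinset r) ∪ insert u (G.neighborFinset u)) (r := r) (u := u)
    (w := fun v => if v = r then 8 else if v = u then 1 else if G.Adj u v then 2 else 4)
    (by
      intro x y hxy
      have h1 : x = u → G.Adj u y := by rintro rfl; exact hxy
      have h2 : y = r → G.Adj r x := by rintro rfl; exact hxy.symm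
      have h3 := hcom x
      have h4 : y = r → x = r → False := by rintro rfl rfl; exact hxy.ne rfl
      have h5 : x = u → y = r → False := by rintro rfl rfl; exact hadj hxy.symm
      split_ifs <;> first | omega | tauto)
    (by
      intro x hx y hxy
      simp only [Finset.mem_union, Finset.mem_insert, SimpleGraph.mem_neighborFinset, not_or] at hx
      have h2 : y = r → G.Adj r x := by rintro rfl; exact hxy.symm
      split_ifs <;> first | omega | tauto)
    (by simp) (by simp [hne])
  simp only [if_true] at this
  have h1 := Finset.card_union_le (insert r (G.neighborFinset r)) (insert u (G.neighborFinset u))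
  have h2 := Finset.card_insert_le r (G.neighborFinset r)
  have h3 := Finset.card_insert_le u (G.neighborFinset u)
  simp only [SimpleGraph.card_neighborFinset_eq_degree] at h2 h3
  omega

/-- In a Class 0 graph, if `u` and `r` are at distance at least `4`, then the ball of radius `2`
around `u` and the ball of radius `1` around `r` contain at least `16` vertices. -/
theorem sixteen_le_card_of_dist_ge_four
    (hsol : ∀ (r : V) (p : V → ℕ), ∑ v, p v = Fintype.card V → PebblingSolvable G r p)
    {r u : V} {S : Finset V}
    (hd : ∀ v, (v = r ∨ G.Adj r v) → ¬ (v = u ∨ G.Adj u v ∨ ∃ t, G.Adj u t ∧ G.Adj t v))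
    (hr : r ∈ S) (hr' : ∀ v, G.Adj r v → v ∈ S) (hu : u ∈ S) (hu' : ∀ v, G.Adj u v → v ∈ S)
    (hu'' : ∀ t v, G.Adj u t → G.Adj t v → v ∈ S) : 16 ≤ S.card := by
  classical
  have hdr := hd r (Or.inl rfl)
  simp only [not_or] at hdr
  have := weight_le_card_of_solvable hsol (S := S) (r := r) (u := u)
    (w := fun v => if v = r then 16 else if v = u then 1 else if G.Adj u v then 2 else
      if ∃ t, G.Adj u t ∧ G.Adj t v then 4 else 8)
    (by
      intro x y hxy
      have h1 : x = u → G.Adj u y := by rintro rfl; exact hxy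
      have h2 : y = r → G.Adj r x := by rintro rfl; exact hxy.symm
      have h3 := hd x
      have h4 : y = r → x = r → False := by rintro rfl rfl; exact hxy.ne rfl
      have h6 : G.Adj u x → ∃ t, G.Adj u t ∧ G.Adj t y := fun h => ⟨x, h, hxy⟩
      split_ifs <;> first | omega | grind)
    (by
      intro x hx y hxy
      have h0 : x ≠ r := by rintro rfl; exact hx hr
      have h1 : x ≠ u := by rintro rfl; exact hx hu
      have h2 : y ≠ r := by rintro rfl; exact hx (hr' _ hxy.symm)
      have h3 : ¬ G.Adj u x := fun h => hx (hu' _ h)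
      have h4 : ¬ ∃ t, G.Adj u t ∧ G.Adj t x := fun ⟨t, h, h'⟩ => hx (hu'' _ _ h h')
      split_ifs <;> first | omega | grind)
    hr (by simp [Ne.symm hdr.1])
  simpa using this

end

/-- Interchanging the order of summation over edges between two sets of vertices. -/
theorem sum_mul_card_adj_comm {V : Type*} (G : SimpleGraph V) [DecidableRel G.Adj]
    (s t : Finset V) (g : V → ℤ) :
    ∑ v ∈ s, g v * ((t.filter (G.Adj v)).card : ℤ) =
      ∑ u ∈ t, ∑ v ∈ s.filter (G.Adj u), g v := by
  simp only [Finset.card_filter, Finset.sum_filter, Nat.cast_sum, Finset.mul_sum]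
  rw [Finset.sum_comm]
  refine Finset.sum_congr rfl fun u _ => Finset.sum_congr rfl fun v _ => ?_
  simp [G.adj_comm u v]

section

variable {V : Type*} [Fintype V] [DecidableEq V] (G : SimpleGraph V) [DecidableRel G.Adj]

/-- The vertices at distance at least `2` from `r`. -/
def outerVertices (r : V) : Finset V := Finset.univ.filter fun v => v ≠ r ∧ ¬ G.Adj r v

/-- The number of common neighbors of `r` and `v`. -/
def commonDegree (r v : V) : ℕ := (G.neighborFinset v ∩ G.neighborFinset r).card

/-- The charge of a vertex relative to a root `r`. -/
def charge (r v : V) : ℤ := 3 * (G.degree v + commonDegree G r v) - 10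

variable {G}

theorem mem_outerVertices {r v : V} : v ∈ outerVertices G r ↔ v ≠ r ∧ ¬ G.Adj r v := by
  simp [outerVertices]

theorem card_outerVertices (r : V) :
    (outerVertices G r).card + G.degree r + 1 = Fintype.card V := by
  have h : outerVertices G r = (insert r (G.neighborFinset r))ᶜ := by
    ext v; simp [mem_outerVertices]
  have := Finset.card_add_card_compl (insert r (G.neighborFinset r))
  rw [Finset.card_insert_of_notMem (by simp)] at this
  rw [h, ← G.card_neighborFinset_eq_degree r]
  omega

theorem commonDegree_eq_zero_iff {r v : V} :
    commonDegree G r v = 0 ↔ ∀ t, G.Adj v t → ¬ G.Adj r t := by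
  simp [commonDegree, Finset.ext_iff]

theorem card_outer_neighbors {r v : V} (hv : v ∈ outerVertices G r) :
    ((outerVertices G r).filter (G.Adj v)).card + commonDegree G r v = G.degree v := by
  rw [mem_outerVertices] at hv
  have h := Finset.card_sdiff_add_card_inter (G.neighborFinset v) (G.neighborFinset r)
  rw [G.card_neighborFinset_eq_degree v] at h
  rw [← h, commonDegree]
  congr 2
  ext t
  simp only [Finset.mem_filter, mem_outerVertices, Finset.mem_sdiff,
    SimpleGraph.mem_neighborFinset]
  refine ⟨fun h => ⟨h.2, h.1.2⟩, fun h => ⟨⟨?_, h.2⟩, h.1⟩⟩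
  rintro rfl
  exact hv.2 h.1.symm

theorem sum_charge_le (r : V) :
    ∑ v ∈ outerVertices G r, charge G r v + 12 - 4 * G.degree r ≤
      6 * (G.edgeFinset.card : ℤ) - 10 * Fintype.card V + 22 := by
  have hsum := G.sum_degrees_eq_twice_card_edges
  have hsplit : ∑ v, G.degree v = G.degree r + ∑ v ∈ G.neighborFinset r, G.degree v +
      ∑ v ∈ outerVertices G r, G.degree v := by
    have h : outerVertices G r = (insert r (G.neighborFinset r))ᶜ := by
      ext v; simp [mem_outerVertices]
    rw [h, ← Finset.sum_add_sum_compl (insert r (G.neighborFinset r)),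
      Finset.sum_insert (by simp)]
  have hdc : ∑ v ∈ G.neighborFinset r, G.degree v = ∑ v, commonDegree G r v := by
    have := Finset.sum_card_bipartiteAbove_eq_sum_card_bipartiteBelow (s := G.neighborFinset r)
      (t := Finset.univ) (r := G.Adj)
    convert this using 2 with v hv v hv
    · rw [← G.card_neighborFinset_eq_degree v]
      congr 1
      ext; simp [Finset.bipartiteAbove]
    · rw [commonDegree]
      congr 1
      ext; simp [Finset.bipartiteBelow, and_comm, G.adj_comm]
  have hle : G.degree r + ∑ v ∈ outerVertices G r, commonDegree G r v ≤
      ∑ v, commonDegree G r v := by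
    have hr : r ∉ outerVertices G r := by simp [mem_outerVertices]
    have h0 : commonDegree G r r = G.degree r := by
      simp [commonDegree]
    rw [← h0, ← Finset.sum_insert hr]
    exact Finset.sum_le_sum_of_subset (Finset.subset_univ _)
  have hn := card_outerVertices (G := G) r
  have hch : ∑ v ∈ outerVertices G r, charge G r v =
      3 * (((∑ v ∈ outerVertices G r, G.degree v : ℕ) : ℤ) +
        ((∑ v ∈ outerVertices G r, commonDegree G r v : ℕ) : ℤ)) -
        10 * (outerVertices G r).card := by
    simp only [charge, Finset.sum_sub_distrib, ← Finset.mul_sum, Finset.sum_add_distrib]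
    push_cast
    simp [mul_comm]
  rw [hch]
  omega

/-- A vertex of degree `3` whose neighbors have large degree sum if it is far from a vertex `r`
of degree `3`. -/
theorem eleven_le_sum_degree
    (hsol : ∀ (r : V) (p : V → ℕ), ∑ v, p v = Fintype.card V → PebblingSolvable G r p)
    {r u : V} (hr : G.degree r = 3) (hu : u ∈ outerVertices G r)
    (hu0 : commonDegree G r u = 0) (hu1 : ∀ t, G.Adj u t → commonDegree G r t = 0) :
    11 ≤ ∑ t ∈ G.neighborFinset u, G.degree t := by
  rw [mem_outerVertices] at hu
  rw [commonDegree_eq_zero_iff] at hu0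
  simp only [commonDegree_eq_zero_iff] at hu1
  have h := sixteen_le_card_of_dist_ge_four hsol (r := r) (u := u)
    (S := insert r (G.neighborFinset r) ∪ insert u
      ((G.neighborFinset u).biUnion fun t => insert t ((G.neighborFinset t).erase u)))
    (by
      rintro v (rfl | hv) (rfl | hv' | ⟨t, ht, htv⟩)
      · exact hu.1 rfl
      · exact hu.2 hv'.symm
      · exact hu0 _ ht htv.symm
      · exact hu.2 hv
      · exact hu0 _ hv' hv
      · exact hu1 _ ht _ htv hv)
    (by simp) (by intro v hv; simp [hv]) (by simp)
    (by
      intro v hv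
      simp only [Finset.mem_union, Finset.mem_insert, Finset.mem_biUnion]
      exact Or.inr (Or.inr ⟨v, by simpa using hv, Or.inl rfl⟩))
    (by
      intro t v ht htv
      simp only [Finset.mem_union, Finset.mem_insert, Finset.mem_biUnion, Finset.mem_erase]
      by_cases hvu : v = u
      · exact Or.inr (Or.inl hvu)
      · exact Or.inr (Or.inr ⟨t, by simpa using ht, Or.inr ⟨hvu, by simpa using htv⟩⟩))
  have h1 := Finset.card_union_le (insert r (G.neighborFinset r)) (insert u
      ((G.neighborFinset u).biUnion fun t => insert t ((G.neighborFinset t).erase u)))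
  have h2 := Finset.card_insert_le r (G.neighborFinset r)
  have h3 := Finset.card_insert_le u
      ((G.neighborFinset u).biUnion fun t => insert t ((G.neighborFinset t).erase u))
  have h4 : ((G.neighborFinset u).biUnion fun t => insert t ((G.neighborFinset t).erase u)).card ≤
      ∑ t ∈ G.neighborFinset u, G.degree t := by
    refine Finset.card_biUnion_le.trans (Finset.sum_le_sum fun t ht => ?_)
    rw [SimpleGraph.mem_neighborFinset] at ht
    have h5 := Finset.card_insert_le t ((G.neighborFinset t).erase u)
    rw [Finset.card_erase_of_mem (by simpa using ht.symm),
      G.card_neighborFinset_eq_degree t] at h5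
    have := (G.degree_pos_iff_exists_adj t).2 ⟨u, ht.symm⟩
    omega
  rw [G.card_neighborFinset_eq_degree r] at h2
  omega

/-- The edge bound for a Class 0 graph of minimum degree `3`. -/
theorem edge_bound_of_minDegree_three
    (hsol : ∀ (r : V) (p : V → ℕ), ∑ v, p v = Fintype.card V → PebblingSolvable G r p)
    (hdeg : ∀ v, 3 ≤ G.degree v) {r : V} (hr : G.degree r = 3) :
    10 * (Fintype.card V : ℤ) ≤ 6 * (G.edgeFinset.card : ℤ) + 22 := by
  let O := outerVertices G r
  let H := O.filter fun v => commonDegree G r v = 0 ∧ G.degree v = 3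
  let g : V → ℤ := fun v => if commonDegree G r v = 0 then min ((G.degree v : ℤ) - 3) 2 else 2
  have hg : ∀ v, 0 ≤ g v := fun v => by
    have := hdeg v
    simp only [g]
    split_ifs <;> omega
  have hsum := sum_charge_le (G := G) r
  have hcharge : ∀ v ∈ O, g v * ((H.filter (G.Adj v)).card : ℤ) - (if v ∈ H then 2 else 0) ≤
      2 * charge G r v := by
    intro v hv
    have h1 := card_outer_neighbors hv
    have h2 : (H.filter (G.Adj v)).card ≤ (O.filter (G.Adj v)).card :=
      Finset.card_le_card (Finset.filter_subset_filter _ (Finset.filter_subset _ _))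
    have h3 := hdeg v
    have hH : v ∈ H ↔ commonDegree G r v = 0 ∧ G.degree v = 3 := by simp [H, hv]
    have h4 : ((H.filter (G.Adj v)).card : ℤ) ≤ (G.degree v : ℤ) - commonDegree G r v := by
      have : (O.filter (G.Adj v)).card + commonDegree G r v = G.degree v := h1
      omega
    have h5 := mul_le_mul_of_nonneg_left h4 (hg v)
    refine (sub_le_sub_right h5 _).trans ?_
    simp only [hH, charge, g]
    by_cases h0 : commonDegree G r v = 0
    · by_cases h6 : G.degree v = 3
      · simp [h0, h6]
      · by_cases h7 : G.degree v = 4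
        · simp [h0, h7]
        · have : min ((G.degree v : ℤ) - 3) 2 = 2 := min_eq_right (by omega)
          simp only [h0, h6, this, if_true, and_false, if_false]
          omega
    · simp only [h0, if_false, false_and]
      omega
  have hrec : ∀ u ∈ H, 2 ≤ ∑ v ∈ O.filter (G.Adj u), g v := by
    intro u hu
    simp only [H, Finset.mem_filter] at hu
    obtain ⟨huO, hu0, hu3⟩ := hu
    have hN : O.filter (G.Adj u) = G.neighborFinset u := by
      ext t
      simp only [O, Finset.mem_filter, mem_outerVertices, SimpleGraph.mem_neighborFinset]
      refine ⟨fun h => h.2, fun h => ⟨⟨?_, fun h' => ?_⟩, h⟩⟩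
      · rintro rfl
        exact (mem_outerVertices.1 huO).2 h.symm
      · exact commonDegree_eq_zero_iff.1 hu0 t h h'
    rw [hN]
    by_cases hx : ∃ t, G.Adj u t ∧ 2 ≤ g t
    · obtain ⟨t, ht, hgt⟩ := hx
      exact hgt.trans (Finset.single_le_sum (fun v _ => hg v) (by simpa using ht))
    · push Not at hx
      have hx0 : ∀ t, G.Adj u t → commonDegree G r t = 0 := by
        intro t ht
        by_contra h
        simpa [g, h] using hx t ht
      have h11 := eleven_le_sum_degree hsol hr huO hu0 hx0
      have : ∑ v ∈ G.neighborFinset u, g v =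
          ∑ v ∈ G.neighborFinset u, ((G.degree v : ℤ) - 3) := by
        refine Finset.sum_congr rfl fun v hv => ?_
        rw [SimpleGraph.mem_neighborFinset] at hv
        have h1 := hx v hv
        simp only [g, hx0 v hv, if_true] at h1 ⊢
        omega
      rw [this, Finset.sum_sub_distrib, ← Nat.cast_sum]
      simp only [Finset.sum_const, G.card_neighborFinset_eq_degree u, hu3, nsmul_eq_mul,
        Nat.cast_ofNat]
      omega
  have hfin : 0 ≤ ∑ v ∈ O, charge G r v := by
    have h1 := Finset.sum_le_sum hcharge
    rw [Finset.sum_sub_distrib, sum_mul_card_adj_comm G, ← Finset.mul_sum] at h1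
    have h2 := Finset.sum_le_sum hrec
    have h3 : ∑ v ∈ O, (if v ∈ H then (2 : ℤ) else 0) = ∑ v ∈ H, 2 := by
      rw [← Finset.sum_filter]
      congr 1
      ext v
      simp only [H, Finset.mem_filter]
      tauto
    rw [h3] at h1
    linarith
  simp only [hr] at hsum
  simp only [O] at hfin
  omega

end

section

variable {V : Type*} [Fintype V] [DecidableEq V] (G : SimpleGraph V) [DecidableRel G.Adj]

/-- The vertices of degree `2` having exactly one common neighbor with `y`, and not adjacent
to `y`. -/
def lightVertices (y : V) : Finset V :=
  (outerVertices G y).filter fun v => G.degree v = 2 ∧ commonDegree G y v = 1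

/-- The vertices of degree `4` at distance at least `3` from `y` with at least three
light neighbors. -/
def specialVertices (y : V) : Finset V :=
  (outerVertices G y).filter fun v => commonDegree G y v = 0 ∧ G.degree v = 4 ∧
    3 ≤ ((lightVertices G y).filter (G.Adj v)).card

variable {G}

theorem mem_outer_of_adj {y v t : V} (hv : v ∈ outerVertices G y)
    (h0 : commonDegree G y v = 0) (h : G.Adj v t) : t ∈ outerVertices G y := by
  rw [mem_outerVertices] at hv ⊢
  refine ⟨?_, fun h' => commonDegree_eq_zero_iff.1 h0 t h h'⟩
  rintro rfl
  exact hv.2 h.symm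

theorem light_neighbors {y x m : V} (hx : x ∈ lightVertices G y) (hm : m ∈ outerVertices G y)
    (hxm : G.Adj x m) : ∃ α, G.Adj y α ∧ G.Adj x α ∧ ∀ t, G.Adj x t → t = α ∨ t = m := by
  simp only [lightVertices, Finset.mem_filter] at hx
  rw [commonDegree] at hx
  obtain ⟨_, hx2, hx1⟩ := hx
  obtain ⟨α, hα⟩ := Finset.card_eq_one.1 hx1
  have h1 : α ∈ G.neighborFinset x ∩ G.neighborFinset y := by simp [hα]
  simp only [Finset.mem_inter, SimpleGraph.mem_neighborFinset] at h1
  have hne : α ≠ m := by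
    rintro rfl
    exact (mem_outerVertices.1 hm).2 h1.2
  have h2 : ({α, m} : Finset V) = G.neighborFinset x := by
    refine Finset.eq_of_subset_of_card_le ?_ ?_
    · intro t ht
      simp only [Finset.mem_insert, Finset.mem_singleton] at ht
      rcases ht with rfl | rfl <;> simp [h1.1, hxm]
    · rw [G.card_neighborFinset_eq_degree x, hx2, Finset.card_pair hne]
  refine ⟨α, h1.2, h1.1, fun t ht => ?_⟩
  have : t ∈ ({α, m} : Finset V) := by rw [h2]; simpa using ht
  simpa using this

theorem light_mate_unique {y x m m' : V} (hx : x ∈ lightVertices G y)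
    (hm : m ∈ outerVertices G y) (hxm : G.Adj x m) (hm' : m' ∈ outerVertices G y)
    (hxm' : G.Adj x m') : m' = m := by
  obtain ⟨α, hα, -, h⟩ := light_neighbors hx hm hxm
  rcases h m' hxm' with rfl | rfl
  · exact absurd hα (mem_outerVertices.1 hm').2
  · rfl

theorem lightVertices_subset (y : V) : lightVertices G y ⊆ outerVertices G y :=
  Finset.filter_subset _ _

theorem specialVertices_subset (y : V) : specialVertices G y ⊆ outerVertices G y :=
  Finset.filter_subset _ _

theorem special_notMem_light {y w : V} (hw : w ∈ specialVertices G y) :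
    w ∉ lightVertices G y := by
  intro hL
  have h1 := (Finset.mem_filter.1 hw).2.1
  have h2 := (Finset.mem_filter.1 hL).2.2
  omega

theorem exists_light_of_special {y w : V} (hw : w ∈ specialVertices G y) :
    ∃ x ∈ lightVertices G y, G.Adj w x := by
  simp only [specialVertices, Finset.mem_filter] at hw
  obtain ⟨x, hx⟩ := Finset.card_pos.1 (by omega : 0 < ((lightVertices G y).filter (G.Adj w)).card)
  exact ⟨x, by simpa using hx⟩

theorem mem_outer_of_special_adj {y w t : V} (hw : w ∈ specialVertices G y) (h : G.Adj w t) :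
    t ∈ outerVertices G y := by
  simp only [specialVertices, Finset.mem_filter] at hw
  exact mem_outer_of_adj hw.1 hw.2.1 h

/-- Two nonadjacent light vertices with different mates have the same neighbor in `N(y)`. -/
theorem light_anchor_eq
    (hsol : ∀ (r : V) (p : V → ℕ), ∑ v, p v = Fintype.card V → PebblingSolvable G r p)
    {y x m α x' m' α' : V} (hx : x ∈ lightVertices G y) (hx' : x' ∈ lightVertices G y)
    (hm : m ∈ outerVertices G y) (hm' : m' ∈ outerVertices G y)
    (hα : G.Adj y α) (hα' : G.Adj y α')
    (h : ∀ t, G.Adj x t → t = α ∨ t = m) (h' : ∀ t, G.Adj x' t → t = α' ∨ t = m')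
    (hne : x' ≠ x) (hadj : ¬ G.Adj x x') (hmm : m ≠ m') : α = α' := by
  by_contra hαα
  have := six_le_degree_add_degree hsol hne hadj (by
    intro t ht ht'
    rw [mem_outerVertices] at hm hm'
    rcases h t ht with rfl | rfl <;> rcases h' t ht' with rfl | rfl
    · exact hαα rfl
    · exact hm'.2 hα
    · exact hm.2 hα'
    · exact hmm rfl)
  simp only [lightVertices, Finset.mem_filter] at hx hx'
  omega

/-- Adjacent light vertices have different neighbors in `N(y)`. -/
theorem anchor_ne_of_adj_light
    (hsol : ∀ (r : V) (p : V → ℕ), ∑ v, p v = Fintype.card V → PebblingSolvable G r p)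
    {y c d α β : V} (hc : c ∈ lightVertices G y) (hd : d ∈ lightVertices G y)
    (hα : G.Adj y α)
    (h : ∀ t, G.Adj c t → t = α ∨ t = d) (h' : ∀ t, G.Adj d t → t = β ∨ t = c) : α ≠ β := by
  rintro rfl
  have hcO := mem_outerVertices.1 (lightVertices_subset y hc)
  have hdO := mem_outerVertices.1 (lightVertices_subset y hd)
  refine no_cut_vertex_of_solvable hsol (A := {c, d}) (r := c) (c := α) (s := y) (by simp)
    (by simp [hcO.1.symm, hdO.1.symm]) hα.ne ?_
  intro u hu v huv
  simp only [Finset.mem_insert, Finset.mem_singleton] at hu ⊢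
  rcases hu with rfl | rfl
  · have := h v huv; tauto
  · have := h' v huv; tauto

/-- Light vertices with light mates form at most one adjacent pair. -/
theorem adj_of_light_light
    (hsol : ∀ (r : V) (p : V → ℕ), ∑ v, p v = Fintype.card V → PebblingSolvable G r p)
    {y c d e f : V} (hc : c ∈ lightVertices G y) (hd : d ∈ lightVertices G y)
    (he : e ∈ lightVertices G y) (hf : f ∈ lightVertices G y)
    (hcd : G.Adj c d) (hef : G.Adj e f) (hne : e ≠ c) : G.Adj c e := by
  by_contra hce
  have hO := lightVertices_subset (G := G) y
  obtain ⟨α, hα, -, h⟩ := light_neighbors hc (hO hd) hcd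
  obtain ⟨β, hβ, -, h1⟩ := light_neighbors he (hO hf) hef
  obtain ⟨γ, hγ, -, h2⟩ := light_neighbors hf (hO he) hef.symm
  have hβγ := anchor_ne_of_adj_light hsol he hf hβ h1 h2
  have hdf : d ≠ f := by
    rintro rfl
    exact hne (light_mate_unique hd (hO hc) hcd.symm (hO he) hef.symm)
  have hde : d ≠ e := by
    rintro rfl
    exact hce hcd
  have hfc : f ≠ c := by
    rintro rfl
    exact hce hef.symm
  have hcf : ¬ G.Adj c f := fun h3 =>
    hdf (light_mate_unique hc (hO hf) h3 (hO hd) hcd)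
  have e1 := light_anchor_eq hsol hc he (hO hd) (hO hf) hα hβ h h1 hne hce hdf
  have e2 := light_anchor_eq hsol hc hf (hO hd) (hO he) hα hγ h h2 hfc hcf hde
  exact hβγ (e1 ▸ e2)

/-- If there is a special vertex, then no two light vertices are adjacent. -/
theorem not_adj_light_of_special
    (hsol : ∀ (r : V) (p : V → ℕ), ∑ v, p v = Fintype.card V → PebblingSolvable G r p)
    {y c d w : V} (hw : w ∈ specialVertices G y)
    (hc : c ∈ lightVertices G y) (hd : d ∈ lightVertices G y) : ¬ G.Adj c d := by
  intro hcd
  have hO := lightVertices_subset (G := G) y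
  obtain ⟨x, hx, hwx⟩ := exists_light_of_special hw
  have hwO := specialVertices_subset y hw
  have hwL := special_notMem_light hw
  obtain ⟨α, hα, -, h⟩ := light_neighbors hx hwO hwx.symm
  obtain ⟨β, hβ, -, h1⟩ := light_neighbors hc (hO hd) hcd
  obtain ⟨γ, hγ, -, h2⟩ := light_neighbors hd (hO hc) hcd.symm
  have key : ∀ v ∈ lightVertices G y, ¬ G.Adj x v := by
    intro v hv hxv
    have := light_mate_unique hx hwO hwx.symm (hO hv) hxv
    exact hwL (this ▸ hv)
  have hcx : c ≠ x := by rintro rfl; exact key d hd hcd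
  have hdx : d ≠ x := by rintro rfl; exact key c hc hcd.symm
  have hwc : w ≠ c := by rintro rfl; exact hwL hc
  have hwd : w ≠ d := by rintro rfl; exact hwL hd
  have e1 := light_anchor_eq hsol hx hc hwO (hO hd) hα hβ h h1 hcx (key c hc) hwd
  have e2 := light_anchor_eq hsol hx hd hwO (hO hc) hα hγ h h2 hdx (key d hd) hwc
  exact anchor_ne_of_adj_light hsol hc hd hβ h1 h2 (e1 ▸ e2)

/-- With at least two special vertices, all their light neighbors share one neighbor of `y`. -/
theorem exists_common_anchor
    (hsol : ∀ (r : V) (p : V → ℕ), ∑ v, p v = Fintype.card V → PebblingSolvable G r p)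
    {y w w' : V} (hw : w ∈ specialVertices G y) (hw' : w' ∈ specialVertices G y)
    (hne : w ≠ w') :
    ∃ α, G.Adj y α ∧ (∀ x ∈ lightVertices G y, G.Adj w x → ∀ t, G.Adj x t → t = α ∨ t = w) ∧
      (∀ x ∈ lightVertices G y, G.Adj w' x → ∀ t, G.Adj x t → t = α ∨ t = w') := by
  have hwO := specialVertices_subset y hw
  have hwO' := specialVertices_subset y hw'
  have key : ∀ x ∈ lightVertices G y, G.Adj w x → ∀ x' ∈ lightVertices G y, G.Adj w' x' →
      ∀ α α', G.Adj y α → G.Adj y α' → (∀ t, G.Adj x t → t = α ∨ t = w) →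
        (∀ t, G.Adj x' t → t = α' ∨ t = w') → α = α' := by
    intro x hx hwx x' hx' hwx' α α' hα hα' h h'
    refine light_anchor_eq hsol hx hx' hwO hwO' hα hα' h h' ?_
      (not_adj_light_of_special hsol hw hx hx') hne
    rintro rfl
    exact hne (light_mate_unique hx hwO' hwx'.symm hwO hwx.symm)
  obtain ⟨x, hx, hwx⟩ := exists_light_of_special hw
  obtain ⟨x', hx', hwx'⟩ := exists_light_of_special hw'
  obtain ⟨α, hα, -, h⟩ := light_neighbors hx hwO hwx.symm
  obtain ⟨α', hα', -, h'⟩ := light_neighbors hx' hwO' hwx'.symm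
  have hαα := key x hx hwx x' hx' hwx' α α' hα hα' h h'
  subst hαα
  refine ⟨α, hα, fun v hv hwv => ?_, fun v hv hwv => ?_⟩
  · obtain ⟨β, hβ, -, h1⟩ := light_neighbors hv hwO hwv.symm
    rwa [key v hv hwv x' hx' hwx' β α hβ hα h1 h'] at h1
  · obtain ⟨β, hβ, -, h1⟩ := light_neighbors hv hwO' hwv.symm
    rwa [← key x hx hwx v hv hwv α β hα hβ h h1] at h1

theorem card_neighbors_special {y w : V} (hw : w ∈ specialVertices G y) :
    ((G.neighborFinset w).filter (· ∉ lightVertices G y)).card +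
      ((lightVertices G y).filter (G.Adj w)).card = 4 := by
  have h4 : G.degree w = 4 := by
    simp only [specialVertices, Finset.mem_filter] at hw
    exact hw.2.2.1
  have h := Finset.card_filter_add_card_filter_not (s := G.neighborFinset w)
    (· ∈ lightVertices G y)
  have h1 : (G.neighborFinset w).filter (· ∈ lightVertices G y) =
      (lightVertices G y).filter (G.Adj w) := by
    ext t; simp [and_comm]
  rw [h1, G.card_neighborFinset_eq_degree w, h4] at h
  omega

/-- Two special vertices have nonlight neighbors that are close to each other, unless one of these
has large degree. -/
theorem exists_close_nonlight
    (hsol : ∀ (r : V) (p : V → ℕ), ∑ v, p v = Fintype.card V → PebblingSolvable G r p)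
    {y w w' : V} (hw : w ∈ specialVertices G y) (hw' : w' ∈ specialVertices G y)
    (hne : w ≠ w') :
    ∃ z z', G.Adj w z ∧ z ∉ lightVertices G y ∧ G.Adj w' z' ∧ z' ∉ lightVertices G y ∧
      (z = z' ∨ G.Adj z z' ∨ 5 ≤ G.degree z') := by
  by_contra! hcon
  have hwL := special_notMem_light hw
  have hwL' := special_notMem_light hw'
  obtain ⟨α, hα, h, h'⟩ := exists_common_anchor hsol hw hw' hne
  have hOα : α ∉ outerVertices G y := fun h1 => (mem_outerVertices.1 h1).2 hα
  have hwα : w ≠ α := by rintro rfl; exact hOα (specialVertices_subset y hw)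
  have hwα' : w' ≠ α := by rintro rfl; exact hOα (specialVertices_subset y hw')
  have hww : ¬ G.Adj w w' := fun h1 => (hcon w' w h1 hwL' h1.symm hwL).2.1 h1.symm
  let N := (G.neighborFinset w').filter (· ∉ lightVertices G y)
  have h16 := sixteen_le_card_of_dist_ge_four hsol (r := w) (u := w')
    (S := insert w (G.neighborFinset w) ∪ (insert w' (G.neighborFinset w') ∪
      ({α} ∪ N.biUnion fun t => G.neighborFinset t)))
    (by
      rintro v (rfl | hv) (rfl | hv' | ⟨t, ht, htv⟩)
      · exact hne rfl
      · exact hww hv'.symm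
      · by_cases htL : t ∈ lightVertices G y
        · rcases h' t htL ht v htv with h1 | h1
          · exact hwα h1
          · exact hne h1
        · exact (hcon t t htv.symm htL ht htL).1 rfl
      · exact hww hv
      · by_cases hvL : v ∈ lightVertices G y
        · rcases h v hvL hv w' hv'.symm with h1 | h1
          · exact hwα' h1
          · exact hne h1.symm
        · exact (hcon v v hv hvL hv' hvL).1 rfl
      · by_cases htL : t ∈ lightVertices G y
        · rcases h' t htL ht v htv with rfl | rfl
          · exact hOα (mem_outer_of_special_adj hw hv)
          · exact hww hv
        · by_cases hvL : v ∈ lightVertices G y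
          · rcases h v hvL hv t htv.symm with rfl | rfl
            · exact hOα (mem_outer_of_special_adj hw' ht)
            · exact hww ht.symm
          · exact (hcon v t hv hvL ht htL).2.1 htv.symm)
    (by simp) (by intro v hv; simp [hv]) (by simp) (by intro v hv; simp [hv])
    (by
      intro t v ht htv
      simp only [Finset.mem_union, Finset.mem_insert, Finset.mem_biUnion, Finset.mem_singleton,
        SimpleGraph.mem_neighborFinset]
      by_cases htL : t ∈ lightVertices G y
      · have := h' t htL ht v htv
        tauto
      · exact Or.inr (Or.inr (Or.inr ⟨t, by simp [N, ht, htL], htv⟩)))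
  have h1 := Finset.card_union_le (insert w (G.neighborFinset w))
    (insert w' (G.neighborFinset w') ∪ ({α} ∪ N.biUnion fun t => G.neighborFinset t))
  have h2 := Finset.card_union_le (insert w' (G.neighborFinset w'))
    ({α} ∪ N.biUnion fun t => G.neighborFinset t)
  have h3 := Finset.card_union_le {α} (N.biUnion fun t => G.neighborFinset t)
  have h4 := Finset.card_insert_le w (G.neighborFinset w)
  have h5 := Finset.card_insert_le w' (G.neighborFinset w')
  have h6 : (N.biUnion fun t => G.neighborFinset t).card ≤ N.card * 4 := by
    refine Finset.card_biUnion_le_card_mul _ _ _ fun t ht => ?_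
    obtain ⟨z, hz⟩ : ∃ z, G.Adj w z ∧ z ∉ lightVertices G y := by
      by_contra! hall
      have hyO : y ∉ outerVertices G y := by simp [mem_outerVertices]
      refine no_cut_vertex_of_solvable hsol (A := insert w (G.neighborFinset w)) (r := w) (c := α)
        (s := y) (by simp) ?_ hα.ne ?_
      · simp only [Finset.mem_insert, SimpleGraph.mem_neighborFinset, not_or]
        refine ⟨?_, fun h1 => hyO (mem_outer_of_special_adj hw h1)⟩
        rintro rfl
        exact hyO (specialVertices_subset y hw)
      · intro u hu v huv
        simp only [Finset.mem_insert, SimpleGraph.mem_neighborFinset] at hu ⊢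
        rcases hu with rfl | hu
        · exact Or.inl (Or.inr huv)
        · have := h u (hall u hu) hu v huv
          tauto
    simp only [N, Finset.mem_filter, SimpleGraph.mem_neighborFinset] at ht
    have := (hcon z t hz.1 hz.2 ht.1 ht.2).2.2
    rw [G.card_neighborFinset_eq_degree t]
    omega
  have h7 := card_neighbors_special hw'
  simp only [specialVertices, Finset.mem_filter] at hw hw'
  simp only [G.card_neighborFinset_eq_degree w, G.card_neighborFinset_eq_degree w',
    Finset.card_singleton] at h3 h4 h5
  have : N.card + ((lightVertices G y).filter (G.Adj w')).card = 4 := h7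
  omega

end

section

variable {V : Type*} [Fintype V] [DecidableEq V] {G : SimpleGraph V} [DecidableRel G.Adj]

/-- A lower bound on the charge of a vertex that is not light. -/
theorem charge_of_notMem_light
    (hsol : ∀ (r : V) (p : V → ℕ), ∑ v, p v = Fintype.card V → PebblingSolvable G r p)
    (hdeg : ∀ v, 2 ≤ G.degree v) {y v : V} (hy : G.degree y = 2) (hv : v ∈ outerVertices G y)
    (hvL : v ∉ lightVertices G y) :
    (((outerVertices G y).filter (G.Adj v)).card : ℤ) ≤ charge G y v ∨
      (commonDegree G y v = 0 ∧ G.degree v = 4 ∧ charge G y v = 2 ∧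
        ((outerVertices G y).filter (G.Adj v)).card = 4) := by
  have h1 := card_outer_neighbors hv
  have h2 := hdeg v
  have h3 : commonDegree G y v = 0 → 4 ≤ G.degree v := fun h0 => by
    have hO := mem_outerVertices.1 hv
    have := six_le_degree_add_degree hsol hO.1 hO.2
      fun t ht ht' => commonDegree_eq_zero_iff.1 h0 t ht' ht
    omega
  have h4 : ¬ (G.degree v = 2 ∧ commonDegree G y v = 1) := fun h =>
    hvL (Finset.mem_filter.2 ⟨hv, h⟩)
  simp only [charge]
  omega

theorem charge_of_mem_light {y v : V} (hvL : v ∈ lightVertices G y) :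
    charge G y v = -1 ∧ ((outerVertices G y).filter (G.Adj v)).card = 1 := by
  obtain ⟨hv, h2, h3⟩ := Finset.mem_filter.1 hvL
  have h1 := card_outer_neighbors hv
  simp only [charge]
  omega

/-- The total charge after every vertex paid one unit to each of its light neighbors. -/
theorem sum_charge_eq (y : V) :
    ∑ v ∈ outerVertices G y, charge G y v = ∑ v ∈ outerVertices G y,
      (charge G y v - ((lightVertices G y).filter (G.Adj v)).card +
        if v ∈ lightVertices G y then 1 else 0) := by
  have h := sum_mul_card_adj_comm G (outerVertices G y) (lightVertices G y) fun _ => 1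
  have h1 : ∑ u ∈ lightVertices G y, ∑ v ∈ (outerVertices G y).filter (G.Adj u), (1 : ℤ) =
      (lightVertices G y).card := by
    rw [Finset.sum_congr rfl fun u hu => ?_, Finset.sum_const, nsmul_eq_mul, mul_one]
    simp [(charge_of_mem_light hu).2]
  have h2 : ∑ v ∈ outerVertices G y, (if v ∈ lightVertices G y then (1 : ℤ) else 0) =
      (lightVertices G y).card := by
    rw [← Finset.sum_filter, Finset.filter_mem_eq_inter,
      Finset.inter_eq_right.2 (lightVertices_subset y)]
    simp
  simp only [one_mul] at h
  rw [Finset.sum_add_distrib, Finset.sum_sub_distrib, h, h1, h2]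
  ring

/-- A sum is at least `-4` if its terms are at least `-2` and no three of them are negative. -/
theorem neg_four_le_sum {ι : Type*} (O : Finset ι) (F : ι → ℤ) (h2 : ∀ v ∈ O, -2 ≤ F v)
    (h3 : (O.filter fun v => F v < 0).card ≤ 2) : -4 ≤ ∑ v ∈ O, F v := by
  have h4 : ∑ v ∈ O, (if F v < 0 then (-2 : ℤ) else 0) ≤ ∑ v ∈ O, F v :=
    Finset.sum_le_sum fun v hv => by
      have := h2 v hv
      split_ifs <;> omega
  rw [← Finset.sum_filter, Finset.sum_const, nsmul_eq_mul] at h4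
  omega

theorem sum_charge_of_special_eq_empty
    (hsol : ∀ (r : V) (p : V → ℕ), ∑ v, p v = Fintype.card V → PebblingSolvable G r p)
    (hdeg : ∀ v, 2 ≤ G.degree v) {y : V} (hy : G.degree y = 2)
    (hW : specialVertices G y = ∅) : -4 ≤ ∑ v ∈ outerVertices G y, charge G y v := by
  rw [sum_charge_eq]
  have hle : ∀ v, ((lightVertices G y).filter (G.Adj v)).card ≤
      ((outerVertices G y).filter (G.Adj v)).card := fun v =>
    Finset.card_le_card (Finset.filter_subset_filter _ (lightVertices_subset y))
  have hnon : ∀ v ∈ outerVertices G y, v ∉ lightVertices G y →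
      0 ≤ charge G y v - ((lightVertices G y).filter (G.Adj v)).card := by
    intro v hv hvL
    have h0 : v ∉ specialVertices G y := by simp [hW]
    simp only [specialVertices, Finset.mem_filter, hv, true_and] at h0
    have h1 := charge_of_notMem_light hsol hdeg hy hv hvL
    have := hle v
    omega
  refine neg_four_le_sum _ _ (fun v hv => ?_) ?_
  · by_cases hvL : v ∈ lightVertices G y
    · have h1 := charge_of_mem_light hvL
      have := hle v
      simp only [hvL, if_true]
      omega
    · have := hnon v hv hvL
      simp only [hvL, if_false]
      omega
  · by_contra! h
    have hB : ∀ v ∈ (outerVertices G y).filter (fun v => charge G y v -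
        ((lightVertices G y).filter (G.Adj v)).card +
        (if v ∈ lightVertices G y then 1 else 0) < 0),
        v ∈ lightVertices G y ∧ ∃ u ∈ lightVertices G y, G.Adj v u := by
      intro v hv
      rw [Finset.mem_filter] at hv
      by_cases hvL : v ∈ lightVertices G y
      · refine ⟨hvL, ?_⟩
        have h1 := charge_of_mem_light hvL
        simp only [hvL, if_true] at hv
        obtain ⟨u, hu⟩ := Finset.card_pos.1
          (by omega : 0 < ((lightVertices G y).filter (G.Adj v)).card)
        exact ⟨u, by simpa using hu⟩
      · have := hnon v hv.1 hvL
        simp only [hvL, if_false] at hv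
        omega
    obtain ⟨c₁, h₁, c₂, h₂, c₃, h₃, h12, h13, h23⟩ := Finset.two_lt_card.1 h
    obtain ⟨l₁, d₁, hd₁, a₁⟩ := hB c₁ h₁
    obtain ⟨l₂, d₂, hd₂, a₂⟩ := hB c₂ h₂
    obtain ⟨l₃, d₃, hd₃, a₃⟩ := hB c₃ h₃
    have hO := lightVertices_subset (G := G) y
    exact h23 (light_mate_unique l₁ (hO l₃) (adj_of_light_light hsol l₁ hd₁ l₃ hd₃ a₁ a₃ h13.symm)
      (hO l₂) (adj_of_light_light hsol l₁ hd₁ l₂ hd₂ a₁ a₂ h12.symm))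

theorem card_light_neighbors_of_light
    (hsol : ∀ (r : V) (p : V → ℕ), ∑ v, p v = Fintype.card V → PebblingSolvable G r p)
    {y v w : V} (hw : w ∈ specialVertices G y) (hv : v ∈ lightVertices G y) :
    ((lightVertices G y).filter (G.Adj v)).card = 0 := by
  rw [Finset.card_eq_zero, Finset.filter_eq_empty_iff]
  exact fun u hu => not_adj_light_of_special hsol hw hv hu

theorem sum_charge_of_special_card_eq_one
    (hsol : ∀ (r : V) (p : V → ℕ), ∑ v, p v = Fintype.card V → PebblingSolvable G r p)
    (hdeg : ∀ v, 2 ≤ G.degree v) {y : V} (hy : G.degree y = 2)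
    (hW : (specialVertices G y).card = 1) : -4 ≤ ∑ v ∈ outerVertices G y, charge G y v := by
  obtain ⟨w, hw⟩ := Finset.card_pos.1 (by omega : 0 < (specialVertices G y).card)
  rw [sum_charge_eq]
  have hle : ∀ v, ((lightVertices G y).filter (G.Adj v)).card ≤
      ((outerVertices G y).filter (G.Adj v)).card := fun v =>
    Finset.card_le_card (Finset.filter_subset_filter _ (lightVertices_subset y))
  have hF : ∀ v ∈ outerVertices G y, -2 ≤ charge G y v -
        ((lightVertices G y).filter (G.Adj v)).card +
        (if v ∈ lightVertices G y then 1 else 0) ∧ (v ∉ specialVertices G y →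
        0 ≤ charge G y v - ((lightVertices G y).filter (G.Adj v)).card +
        (if v ∈ lightVertices G y then 1 else 0)) := by
    intro v hv
    by_cases hvL : v ∈ lightVertices G y
    · have h1 := charge_of_mem_light hvL
      have h2 := card_light_neighbors_of_light hsol hw hvL
      simp only [hvL, if_true]
      omega
    · have h1 := charge_of_notMem_light hsol hdeg hy hv hvL
      have := hle v
      simp only [specialVertices, Finset.mem_filter, hvL, hv, true_and, if_false]
      omega
  refine neg_four_le_sum _ _ (fun v hv => (hF v hv).1) ?_
  refine (Finset.card_le_card (t := specialVertices G y) fun v hv => ?_).trans (by omega)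
  rw [Finset.mem_filter] at hv
  by_contra hvW
  have := (hF v hv.1).2 hvW
  omega

theorem sum_charge_of_two_le_card_special
    (hsol : ∀ (r : V) (p : V → ℕ), ∑ v, p v = Fintype.card V → PebblingSolvable G r p)
    (hdeg : ∀ v, 2 ≤ G.degree v) {y : V} (hy : G.degree y = 2)
    (hW : 1 < (specialVertices G y).card) : -4 ≤ ∑ v ∈ outerVertices G y, charge G y v := by
  let O := outerVertices G y
  let L := lightVertices G y
  let W := specialVertices G y
  have hWL : ∀ w ∈ W, w ∉ L := fun w hw => special_notMem_light hw
  have hone : ∀ w ∈ W, ((G.neighborFinset w).filter (· ∉ L)).card = 1 := by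
    intro w hw
    obtain ⟨w', hw', hne⟩ := Finset.exists_mem_ne hW w
    obtain ⟨z, -, hz, hzL, -⟩ := exists_close_nonlight hsol hw hw' hne.symm
    have h1 := card_neighbors_special hw
    have h2 : 0 < ((G.neighborFinset w).filter (· ∉ L)).card :=
      Finset.card_pos.2 ⟨z, by simp [hz, L, hzL]⟩
    simp only [W, specialVertices, Finset.mem_filter] at hw
    simp only [L] at h2 ⊢
    omega
  have huniq : ∀ w ∈ W, ∀ z z', G.Adj w z → z ∉ L → G.Adj w z' → z' ∉ L → z = z' := by
    intro w hw z z' hz hzL hz' hzL'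
    exact Finset.card_le_one.1 (hone w hw).le z (by simp [hz, hzL]) z' (by simp [hz', hzL'])
  let F : V → ℤ := fun v => charge G y v - (L.filter (G.Adj v)).card + (if v ∈ L then 1 else 0) -
    (if v ∈ L then 0 else 1) * (W.filter (G.Adj v)).card + if v ∈ W then 1 else 0
  have hsum : ∑ v ∈ O, charge G y v = ∑ v ∈ O, F v := by
    have h1 := sum_mul_card_adj_comm G O W fun v => if v ∈ L then 0 else 1
    have h2 : ∑ u ∈ W, ∑ v ∈ O.filter (G.Adj u), (if v ∈ L then (0 : ℤ) else 1) = W.card := by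
      rw [Finset.sum_congr rfl fun u hu => ?_, Finset.sum_const, nsmul_eq_mul, mul_one]
      have h3 : (O.filter (G.Adj u)).filter (· ∉ L) = (G.neighborFinset u).filter (· ∉ L) := by
        ext t
        simp only [Finset.mem_filter, SimpleGraph.mem_neighborFinset]
        exact ⟨fun h => ⟨h.1.2, h.2⟩,
          fun h => ⟨⟨mem_outer_of_special_adj hu h.1, h.1⟩, h.2⟩⟩
      have h4 := hone u hu
      rw [← h3, Finset.card_filter] at h4
      zify at h4
      refine Eq.trans (Finset.sum_congr rfl fun v _ => ?_) h4
      by_cases hvL : v ∈ L <;> simp [hvL]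
    have h5 : ∑ v ∈ O, (if v ∈ W then (1 : ℤ) else 0) = W.card := by
      rw [← Finset.sum_filter, Finset.filter_mem_eq_inter,
        Finset.inter_eq_right.2 (specialVertices_subset y)]
      simp [W]
    have h6 := sum_charge_eq (G := G) y
    simp only [F, Finset.sum_add_distrib, Finset.sum_sub_distrib] at h6 ⊢
    rw [h1, h2, h5]
    simp only [O, L, W] at h6 ⊢
    omega
  have hle : ∀ v, (L.filter (G.Adj v)).card + (W.filter (G.Adj v)).card ≤
      (O.filter (G.Adj v)).card := by
    intro v
    rw [← Finset.card_union_of_disjoint]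
    · refine Finset.card_le_card ?_
      rw [← Finset.filter_union]
      exact Finset.filter_subset_filter _
        (Finset.union_subset (lightVertices_subset y) (specialVertices_subset y))
    · refine Finset.disjoint_filter_filter (Finset.disjoint_left.2 fun w hwL hw => hWL w hw hwL)
  have hF : ∀ v ∈ O, -2 ≤ F v ∧ (F v < 0 → v ∉ L ∧ G.degree v = 4 ∧
      (∃ w ∈ W, G.Adj v w) ∧ (O.filter (G.Adj v)).card = 4 ∧
        (v ∉ W → 3 ≤ (L.filter (G.Adj v)).card + (W.filter (G.Adj v)).card)) := by
    intro v hv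
    by_cases hvL : v ∈ L
    · have h1 : charge G y v = -1 := (charge_of_mem_light hvL).1
      obtain ⟨w, hw⟩ := Finset.card_pos.1 (by omega : 0 < (specialVertices G y).card)
      have h2 : (L.filter (G.Adj v)).card = 0 := card_light_neighbors_of_light hsol hw hvL
      simp only [F, hvL, if_true, h1, h2]
      split_ifs <;> simp
    · have h1 : ((O.filter (G.Adj v)).card : ℤ) ≤ charge G y v ∨ (commonDegree G y v = 0 ∧
          G.degree v = 4 ∧ charge G y v = 2 ∧ (O.filter (G.Adj v)).card = 4) :=
        charge_of_notMem_light hsol hdeg hy hv hvL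
      have h2 := hle v
      have h3 : v ∈ W ↔ commonDegree G y v = 0 ∧ G.degree v = 4 ∧
          3 ≤ (L.filter (G.Adj v)).card := by
        simp only [W, specialVertices, Finset.mem_filter]
        exact ⟨fun h => h.2, fun h => ⟨hv, h⟩⟩
      have h4 : v ∈ W → (L.filter (G.Adj v)).card = 3 := fun hvW => by
        have h5 : ((G.neighborFinset v).filter (· ∉ L)).card + (L.filter (G.Adj v)).card = 4 :=
          card_neighbors_special hvW
        have h6 := hone v hvW
        omega
      simp only [F, hvL, if_false, one_mul, not_false_eq_true, true_and]
      have hex : 0 < (W.filter (G.Adj v)).card → ∃ w ∈ W, G.Adj v w := fun h => by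
        obtain ⟨w, hw⟩ := Finset.card_pos.1 h
        exact ⟨w, by simpa using hw⟩
      by_cases hvW : v ∈ W
      · have h5 := h3.1 hvW
        have h6 := h4 hvW
        simp only [hvW, if_true]
        exact ⟨by omega, fun _ => ⟨by omega, hex (by omega), by omega, fun h => absurd trivial h⟩⟩
      · have h5 := mt h3.2 hvW
        simp only [hvW, if_false]
        exact ⟨by omega, fun _ => ⟨by omega, hex (by omega), by omega, fun _ => by omega⟩⟩
  have hadj : ∀ v ∈ O, ∀ v' ∈ O, F v < 0 → F v' < 0 → v ≠ v' → G.Adj v v' := by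
    intro v hv v' hv' hFv hFv' hne
    obtain ⟨hvL, hv4, ⟨w, hw, hvw⟩, -⟩ := (hF v hv).2 hFv
    obtain ⟨hvL', hv4', ⟨w', hw', hvw'⟩, -⟩ := (hF v' hv').2 hFv'
    have hww : w ≠ w' := by
      rintro rfl
      exact hne (huniq w hw v v' hvw.symm hvL hvw'.symm hvL')
    obtain ⟨z, z', hz, hzL, hz', hzL', h⟩ := exists_close_nonlight hsol hw hw' hww
    obtain rfl := huniq w hw v z hvw.symm hvL hz hzL
    obtain rfl := huniq w' hw' v' z' hvw'.symm hvL' hz' hzL'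
    rcases h with h | h | h
    · exact absurd h hne
    · exact h
    · omega
  rw [hsum]
  refine neg_four_le_sum O F (fun v hv => (hF v hv).1) ?_
  by_contra! hcard
  obtain ⟨a, ha, b, hb, c, hc, hab, hac, hbc⟩ := Finset.two_lt_card.1 hcard
  rw [Finset.mem_filter] at ha hb hc
  have eab := hadj a ha.1 b hb.1 ha.2 hb.2 hab
  have eac := hadj a ha.1 c hc.1 ha.2 hc.2 hac
  have ebc := hadj b hb.1 c hc.1 hb.2 hc.2 hbc
  obtain ⟨haL, -, -, ha4, ha3⟩ := (hF a ha.1).2 ha.2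
  have hbL := ((hF b hb.1).2 hb.2).1
  have hcL := ((hF c hc.1).2 hc.2).1
  have haW : a ∉ W := fun h => hbc (huniq a h b c eab hbL eac hcL)
  have hbW : b ∉ W := fun h => hac (huniq b h a c eab.symm haL ebc hcL)
  have hcW : c ∉ W := fun h => hab (huniq c h a b eac.symm haL ebc.symm hbL)
  have h1 : (L.filter (G.Adj a) ∪ W.filter (G.Adj a)).card ≤ 2 := by
    have h2 : (L.filter (G.Adj a) ∪ W.filter (G.Adj a)) ⊆ (O.filter (G.Adj a)) \ {b, c} := by
      intro t ht
      rw [← Finset.filter_union, Finset.mem_filter, Finset.mem_union] at ht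
      simp only [Finset.mem_sdiff, Finset.mem_filter, Finset.mem_insert, Finset.mem_singleton]
      refine ⟨⟨?_, ht.2⟩, ?_⟩
      · exact ht.1.elim (fun h => lightVertices_subset y h) fun h => specialVertices_subset y h
      · rintro (rfl | rfl) <;> tauto
    refine (Finset.card_le_card h2).trans ?_
    rw [Finset.card_sdiff_of_subset, ha4, Finset.card_pair hbc]
    intro t ht
    simp only [Finset.mem_insert, Finset.mem_singleton] at ht
    rcases ht with rfl | rfl <;> simp_all
  rw [Finset.card_union_of_disjoint
    (Finset.disjoint_filter_filter (Finset.disjoint_left.2 fun w hwL hw => hWL w hw hwL))] at h1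
  have := ha3 haW
  omega

/-- The edge bound for a Class 0 graph of minimum degree `2`. -/
theorem edge_bound_of_minDegree_two
    (hsol : ∀ (r : V) (p : V → ℕ), ∑ v, p v = Fintype.card V → PebblingSolvable G r p)
    (hdeg : ∀ v, 2 ≤ G.degree v) {y : V} (hy : G.degree y = 2) :
    10 * (Fintype.card V : ℤ) ≤ 6 * (G.edgeFinset.card : ℤ) + 22 := by
  have h1 : -4 ≤ ∑ v ∈ outerVertices G y, charge G y v := by
    rcases lt_trichotomy (specialVertices G y).card 1 with h | h | h
    · exact sum_charge_of_special_eq_empty hsol hdeg hy (Finset.card_eq_zero.1 (by omega))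
    · exact sum_charge_of_special_card_eq_one hsol hdeg hy h
    · exact sum_charge_of_two_le_card_special hsol hdeg hy h
  have h2 := sum_charge_le (G := G) y
  rw [hy] at h2
  omega

/-- A connected Class 0 graph with at least three vertices has minimum degree at least `2`. -/
theorem two_le_degree (hG : G.Connected)
    (hsol : ∀ (r : V) (p : V → ℕ), ∑ v, p v = Fintype.card V → PebblingSolvable G r p)
    (hcard : 3 ≤ Fintype.card V) (u : V) : 2 ≤ G.degree u := by
  have : Nontrivial V := Fintype.one_lt_card_iff_nontrivial.1 (by omega)
  have hpos := hG.preconnected.degree_pos_of_nontrivial u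
  by_contra! hlt
  obtain ⟨c, hc⟩ := Finset.card_eq_one.1
    (by rw [G.card_neighborFinset_eq_degree u]; omega : (G.neighborFinset u).card = 1)
  obtain ⟨s, hs⟩ : ∃ s, s ∉ ({u, c} : Finset V) := by
    by_contra! hall
    have h1 := Finset.card_le_card (fun v _ => hall v : Finset.univ ⊆ ({u, c} : Finset V))
    have h2 := Finset.card_le_two (a := u) (b := c)
    rw [Finset.card_univ] at h1
    omega
  simp only [Finset.mem_insert, Finset.mem_singleton, not_or] at hs
  refine no_cut_vertex_of_solvable hsol (A := {u}) (r := u) (c := c) (s := s) (by simp)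
    (by simp [hs.1]) hs.2 ?_
  intro v hv t hvt
  rw [Finset.mem_singleton] at hv
  subst hv
  have : t ∈ G.neighborFinset v := by simpa using hvt
  rw [hc, Finset.mem_singleton] at this
  exact Or.inr this

end

/-- Every configuration of size `|V|` on a nonempty Class 0 graph is solvable. -/
theorem Class0.solvable {V : Type*} [Fintype V] [Nonempty V] {G : SimpleGraph V} (hG : Class0 G) :
    ∀ (r : V) (p : V → ℕ), ∑ v, p v = Fintype.card V → PebblingSolvable G r p := by
  rw [Class0, pebblingNumber] at hG
  have h := Nat.sInf_mem (Nat.nonempty_of_pos_sInf (hG ▸ Fintype.card_pos))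
  rw [hG] at h
  exact h

/-- Every `n`-vertex Class 0 graph with diameter at least 3 has at least
`(5/3)n - 11/3` edges. -/
theorem class0_edge_bound {V : Type*} [Fintype V] [DecidableEq V]
    (G : SimpleGraph V) [DecidableRel G.Adj] (hG : G.Connected) (hG0 : Class0 G)
    (hdiam : 3 ≤ G.diam) :
    (5 / 3 : ℝ) * Fintype.card V - 11 / 3 ≤ (G.edgeFinset.card : ℝ) := by
  have := hG.nonempty
  have hsol := hG0.solvable
  suffices h : 10 * (Fintype.card V : ℤ) ≤ 6 * (G.edgeFinset.card : ℤ) + 22 by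
    have h' : 10 * (Fintype.card V : ℝ) ≤ 6 * (G.edgeFinset.card : ℝ) + 22 := by exact_mod_cast h
    linarith
  by_cases hcard : Fintype.card V < 3
  · omega
  have hdeg := two_le_degree hG hsol (by omega)
  by_cases h2 : ∃ y, G.degree y = 2
  · obtain ⟨y, hy⟩ := h2
    exact edge_bound_of_minDegree_two hsol hdeg hy
  push Not at h2
  have hdeg3 : ∀ v, 3 ≤ G.degree v := fun v => by
    have := hdeg v
    have := h2 v
    omega
  by_cases h3 : ∃ r, G.degree r = 3
  · obtain ⟨r, hr⟩ := h3
    exact edge_bound_of_minDegree_three hsol hdeg3 hr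
  push Not at h3
  have h4 : ∑ _v : V, 4 ≤ ∑ v, G.degree v := Finset.sum_le_sum fun v _ => by
    have := hdeg3 v
    have := h3 v
    omega
  rw [G.sum_degrees_eq_twice_card_edges, Finset.sum_const, Finset.card_univ, smul_eq_mul] at h4
  omega
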